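/- Let m, ℓ, r_1, …, r_ℓ be positive integers with 1 ≤ r_1 < r_2 < ⋯ < r_ℓ ≤ m. Let A be the set of all positive integers a such that a ≡ r_i (mod m) for some i ∈ {1, …, ℓ}, and let p_A(n) denote the number of partitions of n into parts belonging to A. Let c_0 = π√(2ℓ/(3m)). Then for every ε with 0 < ε < 1/2 there exists a constant K = K(ε) such that p_A(n) ≤ K·exp(√(1+ε)·c_0·√n) for all nonnegative integers n. -/

import Mathlib

open Real

/-- The number of partitions of `n` into parts belonging to the set `A`
(with `partCount A 0 = 1`, the empty partition). -/
noncomputable def partCount (A : Set ℕ) (n : ℕ) : ℕ :=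
  Nat.card {p : n.Partition // ∀ i ∈ p.parts, i ∈ A}

/-- Each partition of `n` into parts from `A` contributes a monomial `x ^ n` to the expansion of
`∏ 1 / (1 - x ^ a)`. -/
theorem partCount_mul_pow_le (A : Set ℕ) (n : ℕ) (S : Finset ℕ)
    (hS : ∀ a ∈ A, a ≤ n → a ∈ S) (hpos : ∀ a ∈ S, 0 < a) {x : ℝ} (hx0 : 0 < x) (hx1 : x < 1) :
    (partCount A n : ℝ) * x ^ n ≤ ∏ a ∈ S, (1 - x ^ a)⁻¹ := by
  classical
  let T := Fintype.piFinset fun _ : S => Finset.range (n + 1)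
  let U := T.filter fun c => ∑ a : S, (a : ℕ) * c a = n
  have hmem (p : {p : n.Partition // ∀ i ∈ p.parts, i ∈ A}) : ∀ i ∈ p.1.parts, i ∈ S :=
    fun i hi => hS i (p.2 i hi) (p.1.le_of_mem_parts hi)
  have hsum (p : {p : n.Partition // ∀ i ∈ p.parts, i ∈ A}) :
      ∑ a : S, (a : ℕ) * p.1.parts.count (a : ℕ) = n := by
    rw [Finset.sum_coe_sort S fun a => a * p.1.parts.count a]
    conv_rhs => rw [← p.1.parts_sum]
    rw [Finset.sum_multiset_count_of_subset p.1.parts S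
      fun i hi => hmem p i (Multiset.mem_toFinset.1 hi)]
    exact Finset.sum_congr rfl fun a _ => by rw [smul_eq_mul, mul_comm]
  have hcard : partCount A n ≤ U.card := by
    rw [partCount, Nat.card_eq_fintype_card, ← Finset.card_univ]
    refine Finset.card_le_card_of_injOn (fun p a => p.1.parts.count (a : ℕ)) ?_ ?_
    · intro p _
      simp only [U, T, Finset.coe_filter, Set.mem_ofPred_eq, Fintype.mem_piFinset, Finset.mem_range]
      refine ⟨fun a => Nat.lt_succ_of_le ?_, hsum p⟩
      calc p.1.parts.count (a : ℕ) ≤ (a : ℕ) * p.1.parts.count (a : ℕ) :=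
            Nat.le_mul_of_pos_left _ (hpos a a.2)
        _ ≤ ∑ a : S, (a : ℕ) * p.1.parts.count (a : ℕ) :=
            Finset.single_le_sum (f := fun a : S => (a : ℕ) * p.1.parts.count (a : ℕ))
              (fun _ _ => Nat.zero_le _) (Finset.mem_univ a)
        _ = n := hsum p
    · intro p _ q _ h
      refine Subtype.ext (Nat.Partition.ext (Multiset.ext.2 fun a => ?_))
      by_cases ha : a ∈ S
      · exact congrFun h ⟨a, ha⟩
      · rw [Multiset.count_eq_zero_of_notMem fun hi => ha (hmem p a hi),
          Multiset.count_eq_zero_of_notMem fun hi => ha (hmem q a hi)]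
  calc (partCount A n : ℝ) * x ^ n ≤ U.card * x ^ n := by gcongr
    _ = ∑ c ∈ U, ∏ a : S, (x ^ (a : ℕ)) ^ c a := by
        rw [← nsmul_eq_mul, ← Finset.sum_const]
        refine Finset.sum_congr rfl fun c hc => ?_
        simp_rw [← pow_mul]
        rw [Finset.prod_pow_eq_pow_sum, (Finset.mem_filter.1 hc).2]
    _ ≤ ∑ c ∈ T, ∏ a : S, (x ^ (a : ℕ)) ^ c a :=
        Finset.sum_le_sum_of_subset_of_nonneg (Finset.filter_subset _ _)
          fun c _ _ => by positivity
    _ = ∏ a : S, ∑ j ∈ Finset.range (n + 1), (x ^ (a : ℕ)) ^ j :=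
        (Finset.prod_univ_sum _ _).symm
    _ ≤ ∏ a : S, (1 - x ^ (a : ℕ))⁻¹ := by
        refine Finset.prod_le_prod (fun a _ => by positivity) fun a _ => ?_
        have h1 : x ^ (a : ℕ) < 1 := pow_lt_one₀ hx0.le hx1 (hpos a a.2).ne'
        rw [← tsum_geometric_of_lt_one (by positivity) h1]
        exact (summable_geometric_of_lt_one (by positivity) h1).sum_le_tsum _
          fun _ _ => by positivity
    _ = ∏ a ∈ S, (1 - x ^ a)⁻¹ := Finset.prod_coe_sort S fun a => (1 - x ^ a)⁻¹

theorem inv_one_sub_exp_neg_le {u : ℝ} (hu : 0 < u) : (1 - exp (-u))⁻¹ ≤ 1 / u + 1 := by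
  have h : exp (-u) ≤ (1 + u)⁻¹ := by
    rw [exp_neg]
    exact inv_anti₀ (by positivity) (by linarith [add_one_le_exp u])
  calc (1 - exp (-u))⁻¹ ≤ (1 - (1 + u)⁻¹)⁻¹ := by
        refine inv_anti₀ ?_ (by linarith)
        rw [sub_pos]
        exact inv_lt_one_of_one_lt₀ (by linarith)
    _ = 1 / u + 1 := by
        have : 1 - (1 + u)⁻¹ = u / (1 + u) := by field_simp; ring
        rw [this, inv_div]
        field_simp

/-- A finite piece of an arithmetic progression `r, r + m, r + 2m, …` summed against `exp (-s a)`. -/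
theorem sum_exp_neg_progression_le {m r : ℕ} (hm : 0 < m) (hr : 1 ≤ r) (N : ℕ) {s : ℝ}
    (hs : 0 < s) :
    ∑ q ∈ Finset.range N, exp (-s) ^ (r + m * q) ≤ 1 / (m * s) + exp (-s) := by
  have hm' : (0 : ℝ) < m := by exact_mod_cast hm
  have hy0 := exp_pos (-s)
  have hy1 : exp (-s) < 1 := by rw [exp_lt_one_iff]; linarith
  have hym : exp (-s) ^ m < 1 := pow_lt_one₀ hy0.le hy1 hm.ne'
  have hexp : exp (-s) ^ m = exp (-(m * s)) := by rw [← exp_nat_mul]; ring_nf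
  have hms : 0 < m * s := by positivity
  calc ∑ q ∈ Finset.range N, exp (-s) ^ (r + m * q)
      = exp (-s) ^ r * ∑ q ∈ Finset.range N, (exp (-s) ^ m) ^ q := by
        rw [Finset.mul_sum]
        exact Finset.sum_congr rfl fun q _ => by rw [pow_add, pow_mul]
    _ ≤ exp (-s) * (1 / (m * s) + 1) := by
        refine mul_le_mul (pow_le_of_le_one hy0.le hy1.le (by omega)) ?_ (by positivity) hy0.le
        refine le_trans ?_ (inv_one_sub_exp_neg_le hms)
        rw [← hexp, ← tsum_geometric_of_lt_one (by positivity) hym]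
        exact (summable_geometric_of_lt_one (by positivity) hym).sum_le_tsum _
          fun _ _ => by positivity
    _ ≤ 1 / (m * s) + exp (-s) := by
        have : exp (-s) * (1 / (m * s)) ≤ 1 * (1 / (m * s)) := by gcongr
        linarith

/-- Bound for the Euler product of a finite set of positive integers in terms of its exponential
sums. -/
theorem prod_inv_one_sub_exp_le (S : Finset ℕ) (hpos : ∀ a ∈ S, 0 < a) {B C t : ℝ} (ht : 0 < t)
    (hS : ∀ s : ℝ, 0 < s → ∑ a ∈ S, exp (-s) ^ a ≤ B / s + C * exp (-s)) :
    ∏ a ∈ S, (1 - exp (-t) ^ a)⁻¹ ≤ exp (B * (π ^ 2 / 6) / t - C * log (1 - exp (-t))) := by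
  have hx0 := exp_pos (-t)
  have hx1 : exp (-t) < 1 := by rw [exp_lt_one_iff]; linarith
  have hxa (a : ℕ) (ha : a ∈ S) : exp (-t) ^ a < 1 := pow_lt_one₀ hx0.le hx1 (hpos a ha).ne'
  have hlog (x : ℝ) (h0 : 0 < x) (h1 : x < 1) :
      HasSum (fun k : ℕ => x ^ (k + 1) / (k + 1)) (-log (1 - x)) :=
    hasSum_pow_div_log_of_abs_lt_one (by rwa [abs_of_pos h0])
  have hprod : ∏ a ∈ S, (1 - exp (-t) ^ a)⁻¹ = exp (∑ a ∈ S, -log (1 - exp (-t) ^ a)) := by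
    rw [exp_sum]
    refine Finset.prod_congr rfl fun a ha => ?_
    rw [exp_neg (log _), exp_log (sub_pos.2 (hxa a ha))]
  rw [hprod, exp_le_exp]
  have hL := hasSum_sum fun a (ha : a ∈ S) => hlog _ (pow_pos hx0 a) (hxa a ha)
  have hzeta : HasSum (fun k : ℕ => 1 / ((k : ℝ) + 1) ^ 2) (π ^ 2 / 6) := by
    have := (hasSum_nat_add_iff' (f := fun n : ℕ => 1 / (n : ℝ) ^ 2) 1).2 hasSum_zeta_two
    simpa using this
  have hR := (hzeta.mul_left (B / t)).add ((hlog _ hx0 hx1).mul_left C)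
  refine (hasSum_le (fun k => ?_) hL hR).trans (le_of_eq (by ring))
  have hk : (0 : ℝ) < (k : ℝ) + 1 := by positivity
  have hpow : exp (-t) ^ (k + 1) = exp (-((k + 1) * t)) := by
    rw [← exp_nat_mul]; push_cast; ring_nf
  have key := hS ((k + 1) * t) (by positivity)
  rw [← hpow] at key
  calc ∑ a ∈ S, (exp (-t) ^ a) ^ (k + 1) / ((k : ℝ) + 1)
      = (∑ a ∈ S, (exp (-t) ^ (k + 1)) ^ a) / (k + 1) := by
        rw [Finset.sum_div]
        exact Finset.sum_congr rfl fun a _ => by rw [pow_right_comm]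
    _ ≤ (B / ((k + 1) * t) + C * exp (-t) ^ (k + 1)) / (k + 1) := by gcongr
    _ = B / t * (1 / ((k : ℝ) + 1) ^ 2) + C * (exp (-t) ^ (k + 1) / (k + 1)) := by
        field_simp

/-- The saddle-point inequality for partitions with parts in given residue classes. -/
theorem partCount_residue_le {m ℓ : ℕ} (hm : 0 < m) (r : Fin ℓ → ℕ)
    (hr1 : ∀ i, 1 ≤ r i) (hrm : ∀ i, r i ≤ m) (n : ℕ) {t : ℝ} (ht : 0 < t) :
    (partCount {a : ℕ | 0 < a ∧ ∃ i, a ≡ r i [MOD m]} n : ℝ) ≤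
      exp (n * t + ℓ / m * (π ^ 2 / 6) / t) * (1 / t + 1) ^ ℓ := by
  classical
  set S : Finset ℕ := (Finset.univ ×ˢ Finset.range (n + 1)).image
    fun iq : Fin ℓ × ℕ => r iq.1 + m * iq.2
  have hmem : ∀ a ∈ {a : ℕ | 0 < a ∧ ∃ i, a ≡ r i [MOD m]}, a ≤ n → a ∈ S := by
    rintro a ⟨ha, i, hi⟩ han
    have hra : r i ≤ a := by
      by_contra! h
      have h1 := Nat.le_of_dvd (by omega) ((Nat.modEq_iff_dvd' h.le).1 hi)
      have := hrm i
      omega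
    obtain ⟨q, hq⟩ := (Nat.modEq_iff_dvd' hra).1 hi.symm
    refine Finset.mem_image.2 ⟨(i, q), ?_, by dsimp only; omega⟩
    have : q ≤ m * q := Nat.le_mul_of_pos_left _ hm
    simp only [Finset.mem_product, Finset.mem_univ, Finset.mem_range, true_and]
    omega
  have hpos : ∀ a ∈ S, 0 < a := by
    intro a ha
    obtain ⟨iq, -, rfl⟩ := Finset.mem_image.1 ha
    have := hr1 iq.1
    omega
  have hexp (s : ℝ) (hs : 0 < s) : ∑ a ∈ S, exp (-s) ^ a ≤ ℓ / m / s + ℓ * exp (-s) := by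
    calc ∑ a ∈ S, exp (-s) ^ a
        ≤ ∑ iq ∈ Finset.univ ×ˢ Finset.range (n + 1), exp (-s) ^ (r iq.1 + m * iq.2) :=
          Finset.sum_image_le_of_nonneg (fun _ _ => by positivity)
      _ = ∑ i, ∑ q ∈ Finset.range (n + 1), exp (-s) ^ (r i + m * q) := Finset.sum_product _ _ _
      _ ≤ ∑ _i : Fin ℓ, (1 / (m * s) + exp (-s)) :=
          Finset.sum_le_sum fun i _ => sum_exp_neg_progression_le hm (hr1 i) _ hs
      _ = ℓ / m / s + ℓ * exp (-s) := by
          rw [Finset.sum_const, Finset.card_univ, Fintype.card_fin, nsmul_eq_mul]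
          field_simp
  have hx1 : exp (-t) < 1 := by rw [exp_lt_one_iff]; linarith
  have hmain := (partCount_mul_pow_le _ n S hmem hpos (exp_pos (-t)) hx1).trans
    (prod_inv_one_sub_exp_le S hpos ht hexp)
  have hx : exp (-t) ^ n = (exp (n * t))⁻¹ := by rw [← exp_nat_mul, ← exp_neg]; ring_nf
  have hfac : exp (-(ℓ * log (1 - exp (-t)))) = ((1 - exp (-t))⁻¹) ^ ℓ := by
    rw [exp_neg, exp_nat_mul, exp_log (sub_pos.2 hx1), inv_pow]
  rw [hx, mul_inv_le_iff₀ (exp_pos _), sub_eq_add_neg, exp_add, hfac] at hmain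
  refine hmain.trans ?_
  rw [exp_add (n * t), mul_comm (exp (n * t)), mul_right_comm]
  have : 0 ≤ (1 - exp (-t))⁻¹ := inv_nonneg.2 (sub_pos.2 hx1).le
  gcongr
  exact inv_one_sub_exp_neg_le ht

theorem stmt_16 (m ℓ : ℕ) (hm : 0 < m) (hℓ : 0 < ℓ) (r : Fin ℓ → ℕ)
    (hmono : StrictMono r) (hr1 : ∀ i, 1 ≤ r i) (hrm : ∀ i, r i ≤ m)
    (A : Set ℕ) (hA : A = {a : ℕ | 0 < a ∧ ∃ i, a ≡ r i [MOD m]})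
    (c₀ : ℝ) (hc₀ : c₀ = π * Real.sqrt (2 * ℓ / (3 * m)))
    (ε : ℝ) (hε0 : 0 < ε) (hε1 : ε < 1 / 2) :
    ∃ K : ℝ, ∀ n : ℕ,
      (partCount A n : ℝ) ≤ K * Real.exp (Real.sqrt (1 + ε) * c₀ * Real.sqrt n) := by
  have hm' : (0 : ℝ) < m := by exact_mod_cast hm
  have hℓ' : (0 : ℝ) < ℓ := by exact_mod_cast hℓ
  have hc : 0 < c₀ := by rw [hc₀]; positivity
  have hcsq : c₀ ^ 2 / 4 = ℓ / m * (π ^ 2 / 6) := by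
    rw [hc₀, mul_pow, sq_sqrt (by positivity)]
    field_simp
    ring
  have hsqrt : 1 < √(1 + ε) := by
    rw [lt_sqrt (by norm_num)]
    linarith
  set η : ℝ := (√(1 + ε) - 1) * c₀ / ℓ with hη
  have hη0 : 0 < η := div_pos (mul_pos (sub_pos.2 hsqrt) hc) hℓ'
  set C : ℝ := (1 + 2 / (η * c₀)) ^ ℓ with hC
  have hC0 : 0 < C := by positivity
  refine ⟨C + partCount A 0, fun n => ?_⟩
  rcases Nat.eq_zero_or_pos n with rfl | hn
  · simp [hC0.le]
  have hn' : (0 : ℝ) < n := by exact_mod_cast hn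
  set w : ℝ := √n
  have hw0 : 0 < w := sqrt_pos.2 hn'
  have hnw : (n : ℝ) = w ^ 2 := (sq_sqrt hn'.le).symm
  have hbound := partCount_residue_le hm r hr1 hrm n (t := c₀ / (2 * w)) (by positivity)
  rw [← hA, ← hcsq] at hbound
  have hexponent : n * (c₀ / (2 * w)) + c₀ ^ 2 / 4 / (c₀ / (2 * w)) = c₀ * w := by
    rw [hnw]
    field_simp
    ring
  have hfactor : 1 / (c₀ / (2 * w)) + 1 ≤ (1 + 2 / (η * c₀)) * exp (η * w) := by
    calc 1 / (c₀ / (2 * w)) + 1 ≤ (1 + 2 / (η * c₀)) * (η * w + 1) := by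
          have : (1 + 2 / (η * c₀)) * (η * w + 1) =
              1 / (c₀ / (2 * w)) + 1 + (η * w + 2 / (η * c₀)) := by
            field_simp
            ring
          rw [this]
          exact le_add_of_nonneg_right (by positivity)
      _ ≤ (1 + 2 / (η * c₀)) * exp (η * w) := by
          gcongr
          exact add_one_le_exp _
  calc (partCount A n : ℝ)
      ≤ exp (c₀ * w) * ((1 + 2 / (η * c₀)) * exp (η * w)) ^ ℓ := by
        rw [hexponent] at hbound
        exact hbound.trans (by gcongr)
    _ = C * exp (√(1 + ε) * c₀ * w) := by
        rw [mul_pow, ← hC, ← exp_nat_mul, mul_left_comm, ← exp_add]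
        congr 2
        rw [hη]
        field_simp
        ring
    _ ≤ (C + partCount A 0) * exp (√(1 + ε) * c₀ * w) := by
        gcongr
        exact le_add_of_nonneg_right (Nat.cast_nonneg _)
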